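/- If 2 ≤ q < ∞, then for every ξ, η ∈ ℝⁿ one has ⟨H_{q−1}(ξ) − H_{q−1}(η), ξ − η⟩ ≥ (4/q²) |H_{q/2}(ξ) − H_{q/2}(η)|². -/

import Mathlib

open scoped RealInnerProductSpace

/-- `H_α(ξ) = (|ξ|−1)_+^α ξ/|ξ|` (with value `0` at `ξ = 0`). -/
noncomputable def Hmap (n : ℕ) (a : ℝ) (ξ : EuclideanSpace ℝ (Fin n)) :
    EuclideanSpace ℝ (Fin n) :=
  ((max (‖ξ‖ - 1) 0) ^ a / ‖ξ‖) • ξ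

lemma aux_tangent (p a b : ℝ) (hp : 1 ≤ p) (hb : 0 ≤ b) (ha : 0 < a) :
    a ^ p - b ^ p ≤ p * a ^ (p - 1) * (a - b) := by
  have h := one_add_mul_self_le_rpow_one_add (s := b / a - 1) (p := p)
    (by have : 0 ≤ b / a := by positivity
        linarith) hp
  have e : 1 + (b / a - 1) = b / a := by ring
  rw [e, Real.div_rpow hb ha.le, le_div_iff₀ (by positivity)] at h
  have e2 : a ^ p = a ^ (p - 1) * a := by
    rw [← Real.rpow_add_one ha.ne']; congr 1; ring
  have e3 : (1 + p * (b / a - 1)) * a ^ p = a ^ p - p * a ^ (p - 1) * (a - b) := by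
    rw [e2]; field_simp; ring
  linarith

lemma aux_pow (q a : ℝ) (hq : 2 ≤ q) (ha : 0 ≤ a) :
    (a ^ (q / 2)) ^ 2 = a ^ (q - 1) * a := by
  rw [← Real.rpow_natCast, ← Real.rpow_mul ha]
  rcases ha.eq_or_lt with h | h
  · rw [← h, mul_zero, Real.zero_rpow]; norm_num; linarith
  · rw [← Real.rpow_add_one h.ne']; congr 1; push_cast; ring

lemma aux_scalar (q a b : ℝ) (hq : 2 ≤ q) (hb : 0 ≤ b) (hab : b ≤ a) :
    4 / q ^ 2 * (a ^ (q / 2) - b ^ (q / 2)) ^ 2 ≤ (a ^ (q - 1) - b ^ (q - 1)) * (a - b) := by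
  rcases hab.eq_or_lt with rfl | hlt
  · simp
  have ha : 0 < a := by linarith
  have ht := aux_tangent (q / 2) a b (by linarith) hb ha
  have hm : b ^ (q / 2) ≤ a ^ (q / 2) := Real.rpow_le_rpow hb hab (by linarith)
  have hm1 : b ^ (q / 2 - 1) ≤ a ^ (q / 2 - 1) := Real.rpow_le_rpow hb hab (by linarith)
  have e1 : a ^ (q - 1) = a ^ (q / 2 - 1) * a ^ (q / 2) := by
    rw [← Real.rpow_add ha]; congr 1; ring
  have e2 : b ^ (q - 1) = b ^ (q / 2 - 1) * b ^ (q / 2) := by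
    rw [← Real.rpow_add_of_nonneg hb (by linarith) (by linarith)]; congr 1; ring
  have hB : 0 ≤ b ^ (q / 2) := by positivity
  have h1 : a ^ (q / 2 - 1) * (a ^ (q / 2) - b ^ (q / 2)) ≤ a ^ (q - 1) - b ^ (q - 1) := by
    rw [e1, e2]; nlinarith
  have h2 : (a ^ (q / 2) - b ^ (q / 2)) ^ 2 ≤ q / 2 * ((a ^ (q - 1) - b ^ (q - 1)) * (a - b)) := by
    calc _ = (a ^ (q / 2) - b ^ (q / 2)) * (a ^ (q / 2) - b ^ (q / 2)) := by ring
      _ ≤ (q / 2 * a ^ (q / 2 - 1) * (a - b)) * (a ^ (q / 2) - b ^ (q / 2)) :=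
        mul_le_mul_of_nonneg_right ht (by linarith)
      _ = q / 2 * (a - b) * (a ^ (q / 2 - 1) * (a ^ (q / 2) - b ^ (q / 2))) := by ring
      _ ≤ q / 2 * (a - b) * (a ^ (q - 1) - b ^ (q - 1)) :=
        mul_le_mul_of_nonneg_left h1 (mul_nonneg (by linarith) (by linarith))
      _ = _ := by ring
  have h3 : 0 ≤ (a ^ (q - 1) - b ^ (q - 1)) * (a - b) :=
    mul_nonneg (sub_nonneg.2 (Real.rpow_le_rpow hb hab (by linarith))) (by linarith)
  rw [div_mul_eq_mul_div, div_le_iff₀ (by positivity)]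
  nlinarith

lemma aux_minus (q a b : ℝ) (hq : 2 ≤ q) (ha : 0 ≤ a) (hb : 0 ≤ b) :
    4 / q ^ 2 * (a ^ (q / 2) + b ^ (q / 2)) ^ 2 ≤ (a ^ (q - 1) + b ^ (q - 1)) * (a + b) := by
  have hA := aux_pow q a hq ha
  have hB := aux_pow q b hq hb
  have hx : 0 ≤ a ^ (q - 1) := by positivity
  have hy : 0 ≤ b ^ (q - 1) := by positivity
  have h4 : 4 / q ^ 2 ≤ 1 := by rw [div_le_one (by positivity)]; nlinarith
  have h5 : (a ^ (q / 2) + b ^ (q / 2)) ^ 2 ≤ (a ^ (q - 1) + b ^ (q - 1)) * (a + b) := by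
    have : 2 * (a ^ (q / 2) * b ^ (q / 2)) ≤ a ^ (q - 1) * b + b ^ (q - 1) * a := by
      refine (sq_le_sq₀ (by positivity) (by positivity)).1 ?_
      · have : (2 * (a ^ (q / 2) * b ^ (q / 2))) ^ 2
            = 4 * ((a ^ (q - 1) * a) * (b ^ (q - 1) * b)) := by rw [← hA, ← hB]; ring
        rw [this]
        nlinarith [sq_nonneg (a ^ (q - 1) * b - b ^ (q - 1) * a)]
    nlinarith
  nlinarith [sq_nonneg (a ^ (q / 2) + b ^ (q / 2))]

lemma aux_plus (q r s : ℝ) (hq : 2 ≤ q) (hsr : s ≤ r) :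
    4 / q ^ 2 * ((max (r - 1) 0) ^ (q / 2) - (max (s - 1) 0) ^ (q / 2)) ^ 2 ≤
      ((max (r - 1) 0) ^ (q - 1) - (max (s - 1) 0) ^ (q - 1)) * (r - s) := by
  have hab : max (s - 1) 0 ≤ max (r - 1) 0 := max_le_max (by linarith) le_rfl
  have hb : 0 ≤ max (s - 1) 0 := le_max_right _ _
  refine (aux_scalar q _ _ hq hb hab).trans ?_
  refine mul_le_mul_of_nonneg_left ?_
    (sub_nonneg.2 (Real.rpow_le_rpow hb hab (by linarith)))
  have := le_max_left (s - 1) 0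
  rcases max_cases (r - 1) 0 with h | h <;> linarith

theorem stmt9 (n : ℕ) (q : ℝ) (hq : 2 ≤ q) (ξ η : EuclideanSpace ℝ (Fin n)) :
    ⟪Hmap n (q - 1) ξ - Hmap n (q - 1) η, ξ - η⟫ ≥
      (4 / q ^ 2) * ‖Hmap n (q / 2) ξ - Hmap n (q / 2) η‖ ^ 2 := by
  have key : ∀ (c : ℝ), 0 < c → ∀ x : EuclideanSpace ℝ (Fin n),
      (max (‖x‖ - 1) 0) ^ c / ‖x‖ * ‖x‖ = (max (‖x‖ - 1) 0) ^ c := by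
    intro c hc x
    by_cases h : ‖x‖ = 0
    · rw [h]; simp [Real.zero_rpow hc.ne']
    · field_simp
  obtain ⟨t, ht1, ht2, ht⟩ : ∃ t : ℝ, -1 ≤ t ∧ t ≤ 1 ∧ ⟪ξ, η⟫ = ‖ξ‖ * ‖η‖ * t := by
    have hc := abs_le.1 (abs_real_inner_div_norm_mul_norm_le_one ξ η)
    refine ⟨_, hc.1, hc.2, ?_⟩
    by_cases h : ‖ξ‖ * ‖η‖ = 0
    · rw [h, zero_mul]
      rcases mul_eq_zero.1 h with h | h <;> simp [norm_eq_zero.1 h]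
    · exact (mul_div_cancel₀ _ h).symm
  have k1 := key (q - 1) (by linarith) ξ
  have k2 := key (q - 1) (by linarith) η
  have k3 := key (q / 2) (by linarith) ξ
  have k4 := key (q / 2) (by linarith) η
  have hplus : 4 / q ^ 2 * ((max (‖ξ‖ - 1) 0) ^ (q / 2) - (max (‖η‖ - 1) 0) ^ (q / 2)) ^ 2 ≤
      ((max (‖ξ‖ - 1) 0) ^ (q - 1) - (max (‖η‖ - 1) 0) ^ (q - 1)) * (‖ξ‖ - ‖η‖) := by
    rcases le_total ‖η‖ ‖ξ‖ with h | h
    · exact aux_plus q _ _ hq h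
    · have := aux_plus q _ _ hq h
      linarith
  have hminus : 4 / q ^ 2 * ((max (‖ξ‖ - 1) 0) ^ (q / 2) + (max (‖η‖ - 1) 0) ^ (q / 2)) ^ 2 ≤
      ((max (‖ξ‖ - 1) 0) ^ (q - 1) + (max (‖η‖ - 1) 0) ^ (q - 1)) * (‖ξ‖ + ‖η‖) := by
    refine (aux_minus q _ _ hq (le_max_right _ _) (le_max_right _ _)).trans ?_
    refine mul_le_mul_of_nonneg_left ?_ (by positivity)
    exact add_le_add (max_le (by linarith) (norm_nonneg _)) (max_le (by linarith) (norm_nonneg _))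
  unfold Hmap
  rw [← real_inner_self_eq_norm_sq]
  have ht' : ⟪η, ξ⟫ = ‖ξ‖ * ‖η‖ * t := by rw [real_inner_comm]; exact ht
  simp only [inner_sub_left, inner_sub_right, real_inner_smul_left, real_inner_smul_right,
    real_inner_self_eq_norm_sq, ht, ht', norm_smul, mul_pow, Real.norm_eq_abs, sq_abs]
  generalize (max (‖ξ‖ - 1) 0) ^ (q - 1) = X1 at *
  generalize (max (‖η‖ - 1) 0) ^ (q - 1) = Y1 at *
  generalize (max (‖ξ‖ - 1) 0) ^ (q / 2) = X at *
  generalize (max (‖η‖ - 1) 0) ^ (q / 2) = Y at *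
  generalize X1 / ‖ξ‖ = c1 at *
  generalize Y1 / ‖η‖ = d1 at *
  generalize X / ‖ξ‖ = c at *
  generalize Y / ‖η‖ = d at *
  generalize 4 / q ^ 2 = K at *
  subst k1 k2 k3 k4
  have p1 := mul_le_mul_of_nonneg_left hplus (show 0 ≤ (1 + t) / 2 by linarith)
  have p2 := mul_le_mul_of_nonneg_left hminus (show 0 ≤ (1 - t) / 2 by linarith)
  linarith
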